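/- Let G be a finite simple graph and let C be a cycle in G whose length equals the girth of G (i.e., C is a shortest cycle of G). Let b be a vertex of G not lying on C that has at least two neighbors among the vertices of C. Then G contains a subgraph isomorphic to F1, the graph consisting of two triangles sharing exactly one edge (equivalently, K4 minus an edge), or a subgraph isomorphic to F2, the graph consisting of a 4-cycle u1u2u3u4 together with an additional vertex x adjacent to u1 and u3 (equivalently, the complete bipartite graph K_{2,3}). -/

import Mathlib

/-- `F1` is the graph consisting of two triangles sharing exactly one edge,
i.e. `K₄` minus an edge (here the edge `{0,1}` is missing). -/
def F1 : SimpleGraph (Fin 4) :=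
  SimpleGraph.fromEdgeSet {s(0, 2), s(0, 3), s(1, 2), s(1, 3), s(2, 3)}

/-- `F2` is the complete bipartite graph `K_{2,3}`, i.e. a 4-cycle together with a
vertex adjacent to two opposite vertices of the cycle. -/
def F2 : SimpleGraph (Fin 2 ⊕ Fin 3) := completeBipartiteGraph (Fin 2) (Fin 3)

/-- `G` contains a subgraph isomorphic to `F`. -/
def HasSubgraphIso {W V : Type*} (F : SimpleGraph W) (G : SimpleGraph V) : Prop :=
  ∃ φ : W → V, Function.Injective φ ∧ ∀ a b : W, F.Adj a b → G.Adj (φ a) (φ b)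

lemma SimpleGraph.Walk.IsPath.girth_le_length_add_two {V : Type*} {G : SimpleGraph V}
    {u w b : V} {p : G.Walk u w} (hp : p.IsPath) (hne : u ≠ w) (hb : b ∉ p.support)
    (hu : G.Adj b u) (hw : G.Adj b w) : G.girth ≤ p.length + 2 := by
  have hcycle : (Walk.cons hu (p.concat hw.symm)).IsCycle := by
    refine (Walk.cons_isCycle_iff _ _).2 ⟨hp.concat hb hw.symm, ?_⟩
    rw [Walk.edges_concat, List.concat_eq_append, List.mem_append, List.mem_singleton]
    rintro (h | h)
    · exact hb (p.fst_mem_support_of_mem_edges h)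
    · rw [Sym2.eq_swap, Sym2.congr_left] at h
      exact hne h
  simpa using G.girth_le_length hcycle

lemma hasSubgraphIso_F1 {V : Type*} {G : SimpleGraph V} {a b c d : V} (hab : a ≠ b)
    (hac : G.Adj a c) (had : G.Adj a d) (hbc : G.Adj b c) (hbd : G.Adj b d)
    (hcd : G.Adj c d) : HasSubgraphIso F1 G := by
  refine ⟨![a, b, c, d], ?_, ?_⟩
  · intro i j h
    have := hac.ne
    have := had.ne
    have := hbc.ne
    have := hbd.ne
    have := hcd.ne
    fin_cases i <;> fin_cases j <;> simp_all
  · intro i j h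
    fin_cases i <;> fin_cases j <;> simp_all [F1, G.adj_comm]

lemma hasSubgraphIso_F2 {V : Type*} {G : SimpleGraph V} {u₁ u₂ x y z : V} (hu : u₁ ≠ u₂)
    (hxy : x ≠ y) (hxz : x ≠ z) (hyz : y ≠ z) (hx₁ : G.Adj u₁ x) (hx₂ : G.Adj u₂ x)
    (hy₁ : G.Adj u₁ y) (hy₂ : G.Adj u₂ y) (hz₁ : G.Adj u₁ z) (hz₂ : G.Adj u₂ z) :
    HasSubgraphIso F2 G := by
  have hadj : ∀ i j, G.Adj (![u₁, u₂] i) (![x, y, z] j) := by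
    intro i j
    fin_cases i <;> fin_cases j <;> assumption
  refine ⟨Sum.elim ![u₁, u₂] ![x, y, z], ?_, ?_⟩
  · refine Function.Injective.sumElim ?_ ?_ fun i j => (hadj i j).ne
    · intro i j h
      fin_cases i <;> fin_cases j <;> simp_all
    · intro i j h
      fin_cases i <;> fin_cases j <;> simp_all
  · rintro (i | i) (j | j) h
    · simp [F2] at h
    · exact hadj i j
    · exact (hadj j i).symm
    · simp [F2] at h

lemma SimpleGraph.Walk.exists_adj_of_length_eq_two {V : Type*} {G : SimpleGraph V} {u w : V}
    {p : G.Walk u w} (hp : p.length = 2) : ∃ x, G.Adj u x ∧ G.Adj x w ∧ p.support = [u, x, w] := by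
  match p, hp with
  | .cons (v := x) h₁ (.cons h₂ .nil), _ => exact ⟨x, h₁, h₂, by simp⟩

theorem stmt15 {V : Type*} [Fintype V] (G : SimpleGraph V) (v : V)
    (C : G.Walk v v) (hC : C.IsCycle) (hgirth : (C.length : ℕ∞) = G.girth)
    (b : V) (hb : b ∉ C.support)
    (u₁ u₂ : V) (hu₁ : u₁ ∈ C.support) (hu₂ : u₂ ∈ C.support) (hne : u₁ ≠ u₂)
    (hadj₁ : G.Adj b u₁) (hadj₂ : G.Adj b u₂) :
    HasSubgraphIso F1 G ∨ HasSubgraphIso F2 G := by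
  classical
  have hD := hC.rotate hu₁
  have hlen := C.length_rotate u₁ hu₁
  have hu₂' := (C.mem_support_rotate_iff u₁ hu₁).2 hu₂
  have hb' := mt (C.mem_support_rotate_iff u₁ hu₁).1 hb
  obtain ⟨p, q, hpq⟩ := SimpleGraph.Walk.mem_support_iff_exists_append.1 hu₂'
  rw [hpq] at hD hlen hb'
  have hg : C.length = G.girth := by exact_mod_cast hgirth
  have hp := hD.isPath_of_append_left (SimpleGraph.Walk.not_nil_of_ne hne.symm)
  have hq := hD.isPath_of_append_right (SimpleGraph.Walk.not_nil_of_ne hne)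
  rw [SimpleGraph.Walk.mem_support_append_iff, not_or] at hb'
  have h₁ := hp.girth_le_length_add_two hne hb'.1 hadj₁ hadj₂
  have h₂ := hq.girth_le_length_add_two hne.symm hb'.2 hadj₂ hadj₁
  have h₃ := hD.three_le_length
  have hnodup := hD.support_nodup
  rw [SimpleGraph.Walk.length_append] at hlen h₃
  rw [SimpleGraph.Walk.tail_support_append] at hnodup
  obtain ⟨hp', hq'⟩ | ⟨hp', hq'⟩ | ⟨hp', hq'⟩ :
      p.length = 1 ∧ q.length = 2 ∨ p.length = 2 ∧ q.length = 1 ∨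
        p.length = 2 ∧ q.length = 2 := by omega
  · obtain ⟨x, hx₂, hx₁, hs⟩ := SimpleGraph.Walk.exists_adj_of_length_eq_two hq'
    have hbx : b ≠ x := by
      rintro rfl
      simp [hs] at hb'
    exact .inl (hasSubgraphIso_F1 hbx hadj₁ hadj₂ hx₁ hx₂.symm
      (SimpleGraph.Walk.adj_of_length_eq_one hp'))
  · obtain ⟨x, hx₁, hx₂, hs⟩ := SimpleGraph.Walk.exists_adj_of_length_eq_two hp'
    have hbx : b ≠ x := by
      rintro rfl
      simp [hs] at hb'
    exact .inl (hasSubgraphIso_F1 hbx hadj₁ hadj₂ hx₁.symm hx₂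
      (SimpleGraph.Walk.adj_of_length_eq_one hq').symm)
  · obtain ⟨x, hx₁, hx₂, hs⟩ := SimpleGraph.Walk.exists_adj_of_length_eq_two hp'
    obtain ⟨y, hy₂, hy₁, ht⟩ := SimpleGraph.Walk.exists_adj_of_length_eq_two hq'
    rw [hs] at hb' hnodup
    rw [ht] at hb' hnodup
    have hbx : b ≠ x := by
      rintro rfl
      simp at hb'
    have hby : b ≠ y := by
      rintro rfl
      simp at hb'
    have hxy : x ≠ y := by
      rintro rfl
      simp at hnodup
    exact .inr (hasSubgraphIso_F2 hne hbx hby hxy hadj₁.symm hadj₂.symm hx₁ hx₂.symm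
      hy₁.symm hy₂)
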